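/- arXiv:2507.23390 — 4 statements merged into one kernel-verified Lean document; each statement's English description precedes it below -/
import Mathlib

section
/- Let x1 ∈ ℝ and for t ∈ [0, 1) let ρ(t, x) = gaussianPDFReal (t * x1) ((1 - t)²) x be the density of N(t x1, (1 - t)²), and let v(t, x) = (x1 - x)/(1 - t). Then for every t ∈ [0, 1) and every x ∈ ℝ the continuity equation holds: deriv (fun s => ρ(s, x)) t + deriv (fun y => v(t, y) * ρ(t, y)) x = 0. -/
open ProbabilityTheory

theorem gaussianPDFReal_toNNReal_sq {σ : ℝ} (hσ : 0 < σ) (μ x : ℝ) :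
    gaussianPDFReal μ (Real.toNNReal (σ ^ 2)) x =
      (√(2 * Real.pi))⁻¹ * (σ⁻¹ * Real.exp (-((x - μ) / σ) ^ 2 / 2)) := by
  rw [gaussianPDFReal, Real.coe_toNNReal _ (sq_nonneg σ),
    Real.sqrt_mul (by positivity), Real.sqrt_sq hσ.le, mul_inv, mul_assoc]
  congr 3
  field_simp

theorem cfm_continuity_equation (x1 : ℝ)
    (ρ : ℝ → ℝ → ℝ)
    (hρ : ∀ t x, ρ t x = gaussianPDFReal (t * x1) (Real.toNNReal ((1 - t) ^ 2)) x)
    (v : ℝ → ℝ → ℝ) (hv : ∀ t x, v t x = (x1 - x) / (1 - t)) :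
    ∀ t ∈ Set.Ico (0 : ℝ) 1, ∀ x : ℝ,
      deriv (fun s => ρ s x) t + deriv (fun y => v t y * ρ t y) x = 0 := by
  rintro t ⟨-, ht⟩ x
  have hσ : 1 - t ≠ 0 := (sub_pos.2 ht).ne'
  have hρ' : ∀ s < 1, ∀ y, ρ s y = (√(2 * Real.pi))⁻¹ *
      ((1 - s)⁻¹ * Real.exp (-((y - s * x1) / (1 - s)) ^ 2 / 2)) := fun s hs y => by
    rw [hρ, gaussianPDFReal_toNNReal_sq (sub_pos.2 hs)]
  have h_time : (fun s => ρ s x) =ᶠ[nhds t] fun s => (√(2 * Real.pi))⁻¹ *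
      ((1 - s)⁻¹ * Real.exp (-((x - s * x1) / (1 - s)) ^ 2 / 2)) := by
    filter_upwards [Iio_mem_nhds ht] with s hs using hρ' s hs x
  have h_space : (fun y => v t y * ρ t y) = fun y => (x1 - y) / (1 - t) * ((√(2 * Real.pi))⁻¹ *
      ((1 - t)⁻¹ * Real.exp (-((y - t * x1) / (1 - t)) ^ 2 / 2))) := by
    funext y
    rw [hv, hρ' t ht]
  have hσ_deriv : HasDerivAt (fun s : ℝ => 1 - s) (-1) t := (hasDerivAt_id t).const_sub 1
  have hz_time : HasDerivAt (fun s => (x - s * x1) / (1 - s)) _ t :=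
    (((hasDerivAt_id t).mul_const x1).const_sub x).fun_div hσ_deriv hσ
  have hz_space : HasDerivAt (fun y => (y - t * x1) / (1 - t)) _ x :=
    ((hasDerivAt_id x).sub_const (t * x1)).div_const (1 - t)
  have hρ_time := ((hσ_deriv.fun_inv hσ).fun_mul
    (((hz_time.fun_pow 2).fun_neg.div_const 2).exp)).const_mul (√(2 * Real.pi))⁻¹
  have hflux_space := (((hasDerivAt_id x).const_sub x1).div_const (1 - t)).fun_mul
    (((((hz_space.fun_pow 2).fun_neg.div_const 2).exp).const_mul
      (1 - t)⁻¹).const_mul (√(2 * Real.pi))⁻¹)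
  rw [h_time.deriv_eq, h_space, hρ_time.deriv]
  erw [hflux_space.deriv]
  simp only [id]
  field_simp
  ring
end

section
/- Let K ≥ 1, fix y1 ∈ Fin K, and for t ∈ [0, 1) define the conditional marginal p(t, j) = t * (if j = y1 then 1 else 0) + (1 - t)/K and the rate matrix Q(t, i, j) = if i = y1 then 0 else (if j = y1 then 1/(1 - t) else if j = i then −1/(1 - t) else 0). Then for every j ∈ Fin K and every t ∈ [0, 1), the Kolmogorov forward equation holds: the function s ↦ p(s, j) has derivative at t equal to ∑_{i ∈ Fin K} p(t, i) * Q(t, i, j). -/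
theorem dfm_kolmogorov_forward (K : ℕ) (hK : 1 ≤ K) (y1 : Fin K)
    (p : ℝ → Fin K → ℝ)
    (hp : ∀ t j, p t j = t * (if j = y1 then 1 else 0) + (1 - t) / K)
    (Q : ℝ → Fin K → Fin K → ℝ)
    (hQ : ∀ t i j, Q t i j =
      if i = y1 then 0 else
        (if j = y1 then 1 / (1 - t) else if j = i then -(1 / (1 - t)) else 0)) :
    ∀ j : Fin K, ∀ t ∈ Set.Ico (0 : ℝ) 1,
      HasDerivAt (fun s => p s j) (∑ i : Fin K, p t i * Q t i j) t := by
  intro j t ht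
  have hK0 : (K : ℝ) ≠ 0 := by positivity
  have ht0 : 1 - t ≠ 0 := sub_ne_zero.mpr ht.2.ne'
  have flux (i : Fin K) : p t i * Q t i j =
      ((if j = y1 then 1 else 0) - (if j = i then 1 else 0)) / K := by
    rw [hp, hQ]
    by_cases hi : i = y1
    · simp [hi]
    · by_cases hj : j = y1
      · have hji : y1 ≠ i := Ne.symm hi
        simp only [hi, hj, hji, if_true, if_false]
        field_simp
        ring
      · by_cases hji : j = i
        · simp only [hi, hji, if_true, if_false]
          field_simp
          ring
        · simp [hi, hj, hji]
  have total : ∑ i : Fin K, p t i * Q t i j =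
      1 * (if j = y1 then 1 else 0) + (-1) / (K : ℝ) := by
    simp only [flux]
    rw [← Finset.sum_div, Finset.sum_sub_distrib]
    simp only [Finset.sum_const, Finset.card_univ, Fintype.card_fin, nsmul_eq_mul,
      Finset.sum_ite_eq, Finset.mem_univ, if_true]
    field_simp
    ring
  rw [total]
  simp only [hp]
  exact ((hasDerivAt_id t).mul_const _).add (((hasDerivAt_id t).const_sub 1).div_const _)
end

section
/- Let K ≥ 1, fix y1 ∈ Fin K, and for t ∈ [0, 1) define p(t, j) = t * (if j = y1 then 1 else 0) + (1 - t)/K and Q(t, i, j) = if i = y1 then 0 else (if j = y1 then 1/(1 - t) else if j = i then −1/(1 - t) else 0). Then for all real t, Δt with 0 ≤ t < 1, Δt ≥ 0 and t + Δt ≤ 1, the explicit Euler step of the DFM conditional flow is exact: for every j ∈ Fin K, ∑_{i ∈ Fin K} p(t, i) * ((if i = j then 1 else 0) + Q(t, i, j) * Δt) = p(t + Δt, j). -/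
theorem dfm_euler_step_exact (K : ℕ) (hK : 1 ≤ K) (y1 : Fin K)
    (p : ℝ → Fin K → ℝ)
    (hp : ∀ t j, p t j = t * (if j = y1 then 1 else 0) + (1 - t) / K)
    (Q : ℝ → Fin K → Fin K → ℝ)
    (hQ : ∀ t i j, Q t i j =
      if i = y1 then 0 else
        (if j = y1 then 1 / (1 - t) else if j = i then -(1 / (1 - t)) else 0))
    (t Δt : ℝ) (ht0 : 0 ≤ t) (ht1 : t < 1) (hΔt : 0 ≤ Δt) (htΔt : t + Δt ≤ 1) :
    ∀ j : Fin K,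
      ∑ i : Fin K, p t i * ((if i = j then 1 else 0) + Q t i j * Δt)
        = p (t + Δt) j := by
  have hs : 1 - t ≠ 0 := by linarith
  have hK0 : (K : ℝ) ≠ 0 := by
    exact_mod_cast Nat.one_le_iff_ne_zero.mp hK
  intro j
  by_cases hj : j = y1
  · subst hj
    have hterm : ∀ i : Fin K, p t i * ((if i = j then 1 else 0) + Q t i j * Δt)
        = Δt / K + if i = j then t + (1 - t) / K - Δt / K else 0 := by
      intro i
      by_cases hi : i = j
      · simp [hp, hQ, hi]
      · simp only [hp, hQ, hi, if_true, if_false]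
        field_simp
        ring
    rw [Finset.sum_congr rfl (fun i _ => hterm i)]
    simp only [Finset.sum_add_distrib, Finset.sum_const, Finset.card_univ,
      Fintype.card_fin, nsmul_eq_mul, Finset.sum_ite_eq', Finset.mem_univ, if_true, hp]
    field_simp
    ring
  · have hterm : ∀ i : Fin K, i ≠ j →
        p t i * ((if i = j then 1 else 0) + Q t i j * Δt) = 0 := by
      intro i hi
      simp [hQ, hj, hi, hi.symm]
    rw [Finset.sum_eq_single j (fun i _ hi => hterm i hi) (by simp)]
    simp only [hp, hQ, hj, if_true, if_false]
    field_simp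
    ring
end

section
/- Let A : Matrix (Fin m) (Fin n) ℝ, b : Fin m → ℝ, w : EuclideanSpace ℝ (Fin n), and γ : ℝ, and define the guidance target f(x) = ⟪w, x⟫ + γ * ∑_{j} (max ((A *ᵥ x) j − b j) 0)² on EuclideanSpace ℝ (Fin n). Then f is differentiable everywhere and at every x its gradient is w + (2 * γ) • (Aᵀ *ᵥ (fun j => max ((A *ᵥ x) j − b j) 0)), i.e. HasGradientAt f (w + (2 * γ) • (Aᵀ *ᵥ fun j => max ((A *ᵥ x) j − b j) 0)) x. -/
open scoped RealInnerProductSpace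

theorem hasDerivAt_max_zero_sq (t : ℝ) :
    HasDerivAt (fun s : ℝ => (max s 0) ^ 2) (2 * max t 0) t := by
  have hremainder : HasFDerivAt
      (fun s : ℝ => (max s 0) ^ 2 - (2 * max t 0 * (s - t) + (max t 0) ^ 2))
      (0 : ℝ →L[ℝ] ℝ) t := by
    refine Asymptotics.IsBigO.hasFDerivAt (n := 2) (.of_bound 1 (.of_forall fun s => ?_))
      one_lt_two
    simp only [Real.norm_eq_abs, sq_abs, abs_sq, one_mul]
    rw [abs_le]
    rcases max_cases s 0 with ⟨hs, hs'⟩ | ⟨hs, hs'⟩ <;>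
      rcases max_cases t 0 with ⟨ht, ht'⟩ | ⟨ht, ht'⟩ <;> rw [hs, ht] <;>
      constructor <;> nlinarith [sq_nonneg (s - t), sq_nonneg s, sq_nonneg t]
  have hlinear : HasDerivAt (fun s : ℝ => 2 * max t 0 * (s - t) + (max t 0) ^ 2)
      (2 * max t 0) t := by
    simpa using (((hasDerivAt_id t).sub_const t).const_mul (2 * max t 0)).add_const ((max t 0) ^ 2)
  simpa using hremainder.hasDerivAt.fun_add hlinear

theorem hasFDerivAt_mulVec_apply {m n : ℕ} (A : Matrix (Fin m) (Fin n) ℝ) (j : Fin m)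
    (x : EuclideanSpace ℝ (Fin n)) :
    HasFDerivAt (fun y : EuclideanSpace ℝ (Fin n) => (A.mulVec y) j)
      (innerSL ℝ (WithLp.toLp 2 (A j) : EuclideanSpace ℝ (Fin n))) x := by
  convert (innerSL ℝ (WithLp.toLp 2 (A j) : EuclideanSpace ℝ (Fin n))).hasFDerivAt using 1
  ext y
  simp [Matrix.mulVec, dotProduct, PiLp.inner_apply, mul_comm]

theorem fmip_guidance_target_gradient (m n : ℕ)
    (A : Matrix (Fin m) (Fin n) ℝ) (b : Fin m → ℝ)
    (w : EuclideanSpace ℝ (Fin n)) (γ : ℝ)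
    (f : EuclideanSpace ℝ (Fin n) → ℝ)
    (hf : ∀ x, f x = ⟪w, x⟫
        + γ * ∑ j, (max ((A.mulVec x) j - b j) 0) ^ 2) :
    ∀ x : EuclideanSpace ℝ (Fin n),
      HasGradientAt f
        (w + (2 * γ) •
          (WithLp.equiv 2 (Fin n → ℝ)).symm
            (A.transpose.mulVec fun j => max ((A.mulVec x) j - b j) 0)) x := by
  intro x
  rw [hasGradientAt_iff_hasFDerivAt, funext hf]
  have hpenalty (j : Fin m) := (hasDerivAt_max_zero_sq ((A.mulVec x) j - b j)).comp_hasFDerivAt x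
    ((hasFDerivAt_mulVec_apply A j x).sub_const (b j))
  refine ((innerSL ℝ w).hasFDerivAt.add
    ((HasFDerivAt.fun_sum fun j (_ : j ∈ Finset.univ) => hpenalty j).const_mul γ)).congr_fderiv ?_
  ext v
  simp only [map_add, map_smul, add_apply, smul_apply,
    InnerProductSpace.toDual_apply_apply, sum_apply, innerSL_apply_apply,
    smul_eq_mul]
  congr 1
  simp only [PiLp.inner_apply, WithLp.equiv_symm_apply, Matrix.mulVec, dotProduct,
    Matrix.transpose_apply, RCLike.inner_apply, conj_trivial, Finset.mul_sum]
  rw [Finset.sum_comm]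
  refine Finset.sum_congr rfl fun j _ => Finset.sum_congr rfl fun i _ => ?_
  ring
end
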